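/- arXiv:1911.10936 — 2 statements merged into one kernel-verified Lean document; each statement's English description precedes it below -/
import Mathlib

section
/- Let 0 ≤ t < T and let x ∈ ℝ⁴ satisfy x₁ < x₂ < x₃ < x₄ (so that x^o = x and θ·x < 0). Then for each i ∈ {1,2,3,4} the partial derivative ∂_{x_i} u^T(t,x) exists and equals (1/(16√2)) ∫_{−∞}^{∞} (e^{−(T−t) r²}/r) Σ_{k=1}^4 α_{k,i} [ ψ(r θ·x + π/2) sin(r α_k·x) + ψ(r θ·x) cos(r α_k·x) ] dr + 1/4. -/
open MeasureTheory Finset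

noncomputable section

/-- The 2π-periodic square wave ψ(r) = sign(sin r). -/
def psi (r : ℝ) : ℝ := Real.sign (Real.sin r)

/-- The vectors α_k ∈ ℝ⁴, α_{k,j} = 3/√2 if k = j and −1/√2 otherwise. -/
def alph : Fin 4 → Fin 4 → ℝ := fun k j => if k = j then 3 / Real.sqrt 2 else -(1 / Real.sqrt 2)

/-- The vector θ = (1/√2)(1,1,−1,−1) ∈ ℝ⁴. -/
def theta : Fin 4 → ℝ :=
  ![1 / Real.sqrt 2, 1 / Real.sqrt 2, -(1 / Real.sqrt 2), -(1 / Real.sqrt 2)]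

/-- Euclidean dot product on ℝ⁴. -/
def dot (a b : Fin 4 → ℝ) : ℝ := ∑ j, a j * b j

/-- The auxiliary function Λ(r,x). -/
def Lam (r : ℝ) (x : Fin 4 → ℝ) : ℝ :=
  psi (r * dot theta x + Real.pi / 2) * (∑ k, Real.cos (r * dot (alph k) x)) - 4
    - psi (r * dot theta x) * (∑ k, Real.sin (r * dot (alph k) x))

/-- x^o : the increasing rearrangement of the coordinates of x. -/
def sortv (x : Fin 4 → ℝ) : Fin 4 → ℝ := fun i => x (Tuple.sort x i)

/-- The function u^T(t,x). -/
def u (T t : ℝ) (x : Fin 4 → ℝ) : ℝ :=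
  -(1 / (16 * Real.sqrt 2)) *
      (∫ r : ℝ, Real.exp (-(T - t) * r ^ 2) * Lam r (sortv x) / r ^ 2)
    + (1 / 4) * ∑ i, x i + (1 / 2) * Real.sqrt ((T - t) * Real.pi / 2)

/-- Partial derivative in the i-th coordinate. -/
def pd (i : Fin 4) (f : (Fin 4 → ℝ) → ℝ) (x : Fin 4 → ℝ) : ℝ :=
  deriv (fun s => f (Function.update x i s)) (x i)

def bet : Fin 4 → ℝ := ![Real.sqrt 2, -Real.sqrt 2, 0, 0]

def gam : Fin 4 → ℝ := ![0, 0, Real.sqrt 2, -Real.sqrt 2]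

def GG (p b c : ℝ) : ℝ :=
  2 * |Real.cos p| * (Real.cos b + Real.cos c) - 4 - 2 * |Real.sin p| * (Real.cos b - Real.cos c)

lemma dot_update (a x : Fin 4 → ℝ) (i : Fin 4) (s : ℝ) :
    dot a (Function.update x i s) = dot a x + a i * (s - x i) := by
  fin_cases i <;> simp [dot, Fin.sum_univ_four, Function.update] <;> ring

lemma inv_sqrt_two : 1 / Real.sqrt 2 = Real.sqrt 2 / 2 := by
  have h : Real.sqrt 2 * Real.sqrt 2 = 2 := Real.mul_self_sqrt (by norm_num)
  have h0 : Real.sqrt 2 ≠ 0 := by positivity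
  field_simp
  nlinarith

lemma alph0 (y : Fin 4 → ℝ) : dot (alph 0) y = dot theta y + dot bet y := by
  have h3 : 3 / Real.sqrt 2 = 3 * (Real.sqrt 2 / 2) := by rw [← inv_sqrt_two]; ring
  simp only [dot, Fin.sum_univ_four, alph, theta, bet, inv_sqrt_two, h3]
  simp
  ring

lemma alph1 (y : Fin 4 → ℝ) : dot (alph 1) y = dot theta y - dot bet y := by
  have h3 : 3 / Real.sqrt 2 = 3 * (Real.sqrt 2 / 2) := by rw [← inv_sqrt_two]; ring
  simp only [dot, Fin.sum_univ_four, alph, theta, bet, inv_sqrt_two, h3]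
  simp
  ring

lemma alph2 (y : Fin 4 → ℝ) : dot (alph 2) y = - dot theta y + dot gam y := by
  have h3 : 3 / Real.sqrt 2 = 3 * (Real.sqrt 2 / 2) := by rw [← inv_sqrt_two]; ring
  simp only [dot, Fin.sum_univ_four, alph, theta, gam, inv_sqrt_two, h3]
  simp
  ring

lemma alph3 (y : Fin 4 → ℝ) : dot (alph 3) y = - dot theta y - dot gam y := by
  have h3 : 3 / Real.sqrt 2 = 3 * (Real.sqrt 2 / 2) := by rw [← inv_sqrt_two]; ring
  simp only [dot, Fin.sum_univ_four, alph, theta, gam, inv_sqrt_two, h3]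
  simp
  ring

lemma rsign_mul_abs (z : ℝ) : Real.sign z * z = |z| := by
  rcases lt_trichotomy z 0 with h | h | h
  · rw [Real.sign_of_neg h, abs_of_neg h]; ring
  · simp [h]
  · rw [Real.sign_of_pos h, abs_of_pos h]; ring

lemma Lam_eq (r : ℝ) (y : Fin 4 → ℝ) :
    Lam r y = GG (r * dot theta y) (r * dot bet y) (r * dot gam y) := by
  unfold Lam GG psi
  rw [Real.sin_add_pi_div_two, ← rsign_mul_abs, ← rsign_mul_abs]
  simp only [Fin.sum_univ_four, alph0, alph1, alph2, alph3, mul_add, mul_sub, mul_neg,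
    Real.cos_add, Real.cos_sub, Real.sin_add, Real.sin_sub, Real.cos_neg, Real.sin_neg]
  ring

lemma cos_diff_sq (u v : ℝ) : |Real.cos u - Real.cos v| ≤ |u + v| * |u - v| / 2 := by
  rw [Real.cos_sub_cos, abs_mul, abs_mul]
  have h1 := Real.abs_sin_le_abs (x := (u + v) / 2)
  have h2 := Real.abs_sin_le_abs (x := (u - v) / 2)
  rw [abs_div] at h1 h2
  have := mul_le_mul h1 h2 (abs_nonneg _) (by positivity)
  norm_num at this ⊢
  nlinarith

lemma sin_diff (u v : ℝ) : |Real.sin u - Real.sin v| ≤ |u - v| := by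
  rw [Real.sin_sub_sin, abs_mul, abs_mul]
  have h1 := Real.abs_sin_le_abs (x := (u - v) / 2)
  have h2 := Real.abs_cos_le_one ((u + v) / 2)
  rw [abs_div] at h1
  have := mul_le_mul h1 h2 (abs_nonneg _) (by positivity)
  norm_num at this ⊢
  nlinarith

lemma cos_diff (u v : ℝ) : |Real.cos u - Real.cos v| ≤ |u - v| := by
  rw [← Real.sin_add_pi_div_two, ← Real.sin_add_pi_div_two]
  have := sin_diff (u + Real.pi / 2) (v + Real.pi / 2)
  simpa using this

lemma cos_diff_r {r p q M D : ℝ} (hp : |p| ≤ M) (hq : |q| ≤ M) (hD : |p - q| ≤ D) :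
    |Real.cos (r * p) - Real.cos (r * q)| ≤ r ^ 2 * M * D := by
  refine (cos_diff_sq _ _).trans ?_
  have h1 : |p + q| ≤ 2 * M := (abs_add_le _ _).trans (by linarith)
  rw [← mul_add, ← mul_sub, abs_mul, abs_mul]
  have := mul_le_mul h1 hD (abs_nonneg _) ((abs_nonneg _).trans h1)
  have h3 := mul_le_mul_of_nonneg_left this (sq_nonneg r)
  rw [← sq_abs r] at *
  nlinarith

lemma GG_lip {r p b c p' b' c' M D : ℝ}
    (hp : |p| ≤ M) (hb : |b| ≤ M) (hc : |c| ≤ M)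
    (hp' : |p'| ≤ M) (hb' : |b'| ≤ M) (hc' : |c'| ≤ M)
    (dp : |p - p'| ≤ D) (db : |b - b'| ≤ D) (dc : |c - c'| ≤ D) :
    |GG (r * p) (r * b) (r * c) - GG (r * p') (r * b') (r * c')| ≤ 16 * M * r ^ 2 * D := by
  have e1 := cos_diff_r (r := r) hp hp' dp
  have e2 := cos_diff_r (r := r) hb hb' db
  have e3 := cos_diff_r (r := r) hc hc' dc
  have e1' := (abs_abs_sub_abs_le _ _).trans e1
  have e4 : |(|Real.sin (r * p)| - |Real.sin (r * p')|)| * |Real.cos (r * b) - Real.cos (r * c)|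
      ≤ r ^ 2 * (2 * M) * D := by
    have h1 : |(|Real.sin (r * p)| - |Real.sin (r * p')|)| ≤ |r| * D := by
      refine (abs_abs_sub_abs_le _ _).trans ((sin_diff _ _).trans ?_)
      rw [← mul_sub, abs_mul]
      exact mul_le_mul_of_nonneg_left dp (abs_nonneg _)
    have h2 : |Real.cos (r * b) - Real.cos (r * c)| ≤ |r| * (2 * M) := by
      refine (cos_diff _ _).trans ?_
      rw [← mul_sub, abs_mul]
      refine mul_le_mul_of_nonneg_left ?_ (abs_nonneg _)
      exact (abs_sub _ _).trans (by linarith)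
    have := mul_le_mul h1 h2 (abs_nonneg _) ((abs_nonneg _).trans h1)
    rw [← sq_abs r]
    linarith
  have hdec : GG (r * p) (r * b) (r * c) - GG (r * p') (r * b') (r * c') =
      2 * ((|Real.cos (r * p)| - |Real.cos (r * p')|) * (Real.cos (r * b) + Real.cos (r * c)))
      + 2 * (|Real.cos (r * p')| * ((Real.cos (r * b) - Real.cos (r * b'))
          + (Real.cos (r * c) - Real.cos (r * c'))))
      - 2 * ((|Real.sin (r * p)| - |Real.sin (r * p')|) * (Real.cos (r * b) - Real.cos (r * c)))
      - 2 * (|Real.sin (r * p')| * ((Real.cos (r * b) - Real.cos (r * b'))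
          - (Real.cos (r * c) - Real.cos (r * c')))) := by
    unfold GG; ring
  set K := r ^ 2 * M * D with hK
  have t1 : |(|Real.cos (r * p)| - |Real.cos (r * p')|) * (Real.cos (r * b) + Real.cos (r * c))|
      ≤ K * 2 := by
    rw [abs_mul]
    refine mul_le_mul e1' ?_ (abs_nonneg _) ((abs_nonneg _).trans e1')
    refine (abs_add_le _ _).trans ?_
    linarith [Real.abs_cos_le_one (r * b), Real.abs_cos_le_one (r * c)]
  have t2 : |(|Real.cos (r * p')| * ((Real.cos (r * b) - Real.cos (r * b'))
          + (Real.cos (r * c) - Real.cos (r * c'))))| ≤ 1 * (K + K) := by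
    rw [abs_mul, abs_abs]
    exact mul_le_mul (Real.abs_cos_le_one _) ((abs_add_le _ _).trans (add_le_add e2 e3))
      (abs_nonneg _) zero_le_one
  have t3 : |(|Real.sin (r * p)| - |Real.sin (r * p')|) * (Real.cos (r * b) - Real.cos (r * c))|
      ≤ 2 * K := by
    rw [abs_mul]; linarith
  have t4 : |(|Real.sin (r * p')| * ((Real.cos (r * b) - Real.cos (r * b'))
          - (Real.cos (r * c) - Real.cos (r * c'))))| ≤ 1 * (K + K) := by
    rw [abs_mul, abs_abs]
    exact mul_le_mul (Real.abs_sin_le_one _) ((abs_sub _ _).trans (add_le_add e2 e3))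
      (abs_nonneg _) zero_le_one
  have hfin : 16 * M * r ^ 2 * D = 16 * K := by rw [hK]; ring
  rw [hdec, hfin]
  rw [abs_le] at *
  constructor <;> linarith [t1.1, t1.2, t2.1, t2.2, t3.1, t3.2, t4.1, t4.2]

lemma GG_bound {r p b c M : ℝ}
    (hp : |p| ≤ M) (hb : |b| ≤ M) (hc : |c| ≤ M) :
    |GG (r * p) (r * b) (r * c)| ≤ 16 * M * r ^ 2 * M := by
  have hM : 0 ≤ M := (abs_nonneg _).trans hp
  have h := GG_lip (r := r) (p' := 0) (b' := 0) (c' := 0) (D := M) hp hb hc (by simpa) (by simpa)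
    (by simpa) (by simpa) (by simpa) (by simpa)
  have h0 : GG (r * 0) (r * 0) (r * 0) = 0 := by unfold GG; norm_num
  rwa [h0, sub_zero] at h

lemma measurable_psi : Measurable psi := by
  have : Measurable Real.sign := by
    unfold Real.sign
    exact Measurable.ite measurableSet_Iio measurable_const
      (Measurable.ite measurableSet_Ioi measurable_const measurable_const)
  exact this.comp Real.measurable_sin

lemma psi_ev {f : ℝ → ℝ} {s₀ : ℝ} (hf : ContinuousAt f s₀) (h : Real.sin (f s₀) ≠ 0) :
    ∀ᶠ s in nhds s₀, psi (f s) = psi (f s₀) := by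
  have hc : ContinuousAt (fun s => Real.sin (f s)) s₀ :=
    Real.continuous_sin.continuousAt.comp hf
  rcases lt_or_gt_of_ne h with h | h
  · filter_upwards [hc.eventually_lt continuousAt_const h] with s hs
    unfold psi
    rw [Real.sign_of_neg hs, Real.sign_of_neg h]
  · filter_upwards [continuousAt_const.eventually_lt hc h] with s hs
    unfold psi
    rw [Real.sign_of_pos hs, Real.sign_of_pos h]

lemma ae_ne {p : ℝ} (hp : p ≠ 0) :
    ∀ᵐ r : ℝ, Real.sin (r * p) ≠ 0 ∧ Real.sin (r * p + Real.pi / 2) ≠ 0 := by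
  have hc : (Set.range (fun n : ℤ => (n : ℝ) * Real.pi / (2 * p))).Countable :=
    Set.countable_range _
  filter_upwards [hc.ae_notMem volume] with r hr
  have h2 : Real.sin (2 * (r * p)) ≠ 0 := by
    intro h
    obtain ⟨n, hn⟩ := Real.sin_eq_zero_iff.1 h
    apply hr
    refine ⟨n, ?_⟩
    simp only
    rw [hn]
    field_simp
  rw [Real.sin_two_mul] at h2
  rw [Real.sin_add_pi_div_two]
  constructor
  · intro h; simp [h] at h2
  · intro h; simp [h] at h2

lemma Lam_deriv (r : ℝ) (x : Fin 4 → ℝ) (i : Fin 4)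
    (h1 : Real.sin (r * dot theta x) ≠ 0) (h2 : Real.sin (r * dot theta x + Real.pi / 2) ≠ 0) :
    HasDerivAt (fun s => Lam r (Function.update x i s))
      (-(r * ∑ k, alph k i *
              (psi (r * dot theta x + Real.pi / 2) * Real.sin (r * dot (alph k) x)
                + psi (r * dot theta x) * Real.cos (r * dot (alph k) x)))) (x i) := by
  have hlin : ∀ a : Fin 4 → ℝ,
      HasDerivAt (fun s => r * dot a (Function.update x i s)) (r * a i) (x i) := by
    intro a
    simp only [dot_update]
    have := ((((hasDerivAt_id (x i)).sub_const (x i)).const_mul (a i)).const_add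
      (dot a x)).const_mul r
    simpa using this
  have hself : Function.update x i (x i) = x := Function.update_eq_self i x
  have e1 := psi_ev (f := fun s => r * dot theta (Function.update x i s)) (s₀ := x i)
    (hlin theta).continuousAt (by simpa only [hself] using h1)
  have e2 := psi_ev (f := fun s => r * dot theta (Function.update x i s) + Real.pi / 2)
    (s₀ := x i) ((hlin theta).continuousAt.add continuousAt_const)
    (by simpa only [hself] using h2)
  simp only [hself] at e1 e2
  have hd : HasDerivAt (fun s =>
      psi (r * dot theta x + Real.pi / 2) *
        (∑ k, Real.cos (r * dot (alph k) (Function.update x i s))) - 4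
      - psi (r * dot theta x) * (∑ k, Real.sin (r * dot (alph k) (Function.update x i s))))
      (psi (r * dot theta x + Real.pi / 2) *
        (∑ k, (-Real.sin (r * dot (alph k) x) * (r * alph k i)))
      - psi (r * dot theta x) * (∑ k, Real.cos (r * dot (alph k) x) * (r * alph k i))) (x i) := by
    refine HasDerivAt.sub (HasDerivAt.sub_const _ (HasDerivAt.const_mul _ ?_))
      (HasDerivAt.const_mul _ ?_)
    · refine HasDerivAt.fun_sum fun k _ => ?_
      simpa only [hself] using (hlin (alph k)).cos
    · refine HasDerivAt.fun_sum fun k _ => ?_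
      simpa only [hself] using (hlin (alph k)).sin
  have hd2 := hd.congr_of_eventuallyEq (f₁ := fun s => Lam r (Function.update x i s)) (by
    filter_upwards [e1, e2] with s hs1 hs2
    unfold Lam
    rw [hs1, hs2])
  refine hd2.congr_deriv ?_
  simp only [Fin.sum_univ_four]
  ring

lemma sortv_ev (x : Fin 4 → ℝ) (h01 : x 0 < x 1) (h12 : x 1 < x 2) (h23 : x 2 < x 3) (i : Fin 4) :
    ∀ᶠ s in nhds (x i), sortv (Function.update x i s) = Function.update x i s := by
  have hself : Function.update x i (x i) = x := Function.update_eq_self i x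
  have hc : ∀ j, ContinuousAt (fun s => Function.update x i s j) (x i) := by
    intro j
    have h : Continuous (fun s => Function.update x i s) := continuous_const.update i continuous_id
    exact ((continuous_apply j).comp h).continuousAt
  have k01 := (hc 0).eventually_lt (hc 1) (by simpa only [hself] using h01)
  have k12 := (hc 1).eventually_lt (hc 2) (by simpa only [hself] using h12)
  have k23 := (hc 2).eventually_lt (hc 3) (by simpa only [hself] using h23)
  filter_upwards [k01, k12, k23] with s a b c
  have hm : Monotone (Function.update x i s) := by
    rw [Fin.monotone_iff_le_succ]
    intro j
    fin_cases j
    · exact a.le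
    · exact b.le
    · exact c.le
  unfold sortv
  rw [Tuple.sort_eq_refl_iff_monotone.2 hm]
  rfl

lemma coef_theta (i : Fin 4) : |theta i| ≤ 2 := by
  have h : Real.sqrt 2 ≤ 2 := by rw [Real.sqrt_le_left] <;> norm_num
  have h0 := Real.sqrt_nonneg 2
  simp only [theta, inv_sqrt_two]
  fin_cases i <;> simp <;> rw [abs_of_nonneg (by positivity)] <;> linarith

lemma coef_bet (i : Fin 4) : |bet i| ≤ 2 := by
  have h : Real.sqrt 2 ≤ 2 := by rw [Real.sqrt_le_left] <;> norm_num
  have h0 := Real.sqrt_nonneg 2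
  simp only [bet]
  fin_cases i <;> simp <;> rw [abs_of_nonneg h0] <;> linarith

lemma coef_gam (i : Fin 4) : |gam i| ≤ 2 := by
  have h : Real.sqrt 2 ≤ 2 := by rw [Real.sqrt_le_left] <;> norm_num
  have h0 := Real.sqrt_nonneg 2
  simp only [gam]
  fin_cases i <;> simp <;> rw [abs_of_nonneg h0] <;> linarith

lemma int_deriv (c : ℝ) (hc : 0 < c) (x : Fin 4 → ℝ) (hx : dot theta x ≠ 0) (i : Fin 4) :
    HasDerivAt (fun s => ∫ r : ℝ, Real.exp (-c * r ^ 2) * Lam r (Function.update x i s) / r ^ 2)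
      (∫ r : ℝ, -((Real.exp (-c * r ^ 2) / r) *
            ∑ k, alph k i *
              (psi (r * dot theta x + Real.pi / 2) * Real.sin (r * dot (alph k) x)
                + psi (r * dot theta x) * Real.cos (r * dot (alph k) x)))) (x i) := by
  set M := |dot theta x| + |dot bet x| + |dot gam x| + 2 with hM
  have hM0 : 0 ≤ M := by positivity
  have hself : Function.update x i (x i) = x := Function.update_eq_self i x
  have hmeas : ∀ y : Fin 4 → ℝ, Measurable
      (fun r : ℝ => Real.exp (-c * r ^ 2) * Lam r y / r ^ 2) := by
    intro y
    simp only [Lam_eq]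
    unfold GG
    fun_prop
  have hg : Integrable (fun r : ℝ => Real.exp (-c * r ^ 2)) := integrable_exp_neg_mul_sq hc
  have bd : ∀ a : Fin 4 → ℝ, |a i| ≤ 2 → |dot a x| + 2 ≤ M → ∀ s ∈ Metric.ball (x i) 1,
      |dot a (Function.update x i s)| ≤ M := by
    intro a ha hb s hs
    rw [dot_update]
    rw [Metric.mem_ball, Real.dist_eq] at hs
    refine (abs_add_le _ _).trans ?_
    rw [abs_mul]
    nlinarith [abs_nonneg (a i), abs_nonneg (s - x i)]
  have dd : ∀ a : Fin 4 → ℝ, |a i| ≤ 2 → ∀ s s' : ℝ,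
      |dot a (Function.update x i s) - dot a (Function.update x i s')| ≤ 2 * |s - s'| := by
    intro a ha s s'
    rw [dot_update, dot_update]
    have : dot a x + a i * (s - x i) - (dot a x + a i * (s' - x i)) = a i * (s - s') := by ring
    rw [this, abs_mul]
    exact mul_le_mul_of_nonneg_right ha (abs_nonneg _)
  have mt : |dot theta x| + 2 ≤ M := by
    rw [hM]; linarith [abs_nonneg (dot bet x), abs_nonneg (dot gam x)]
  have mb : |dot bet x| + 2 ≤ M := by
    rw [hM]; linarith [abs_nonneg (dot theta x), abs_nonneg (dot gam x)]
  have mg : |dot gam x| + 2 ≤ M := by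
    rw [hM]; linarith [abs_nonneg (dot bet x), abs_nonneg (dot theta x)]
  have key := hasDerivAt_integral_of_dominated_loc_of_lip (μ := volume)
    (F := fun s r => Real.exp (-c * r ^ 2) * Lam r (Function.update x i s) / r ^ 2)
    (F' := fun r => -((Real.exp (-c * r ^ 2) / r) *
            ∑ k, alph k i *
              (psi (r * dot theta x + Real.pi / 2) * Real.sin (r * dot (alph k) x)
                + psi (r * dot theta x) * Real.cos (r * dot (alph k) x))))
    (x₀ := x i) (s := Metric.ball (x i) 1)
    (bound := fun r => 32 * M * Real.exp (-c * r ^ 2))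
    (Metric.ball_mem_nhds _ one_pos)
    (Filter.Eventually.of_forall fun s => (hmeas _).aestronglyMeasurable)
    ?_ ?_ ?_ ?_ ?_
  · exact key.2
  · simp only [hself]
    refine (hg.const_mul (16 * M * M)).mono' (hmeas _).aestronglyMeasurable
      (Filter.Eventually.of_forall fun r => ?_)
    rw [Lam_eq, Real.norm_eq_abs, abs_div, abs_mul, Real.abs_exp, abs_of_nonneg (sq_nonneg r)]
    refine div_le_of_le_mul₀ (sq_nonneg r) (by positivity) ?_
    have := GG_bound (r := r) (p := dot theta x) (b := dot bet x) (c := dot gam x) (M := M)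
      (by linarith) (by linarith) (by linarith)
    have := mul_le_mul_of_nonneg_left this (Real.exp_pos (-c * r ^ 2)).le
    linarith
  · refine Measurable.aestronglyMeasurable ?_
    have := measurable_psi
    simp only [Fin.sum_univ_four]
    fun_prop
  · refine Filter.Eventually.of_forall fun r => ?_
    refine LipschitzOnWith.of_dist_le_mul fun s hs s' hs' => ?_
    rw [Real.dist_eq, Real.dist_eq, Real.coe_nnabs]
    rw [abs_of_nonneg (a := 32 * M * Real.exp (-c * r ^ 2)) (by positivity), ← sub_div, ← mul_sub, abs_div, abs_mul, Real.abs_exp,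
      abs_of_nonneg (sq_nonneg r), Lam_eq, Lam_eq]
    refine div_le_of_le_mul₀ (sq_nonneg r) (by positivity) ?_
    have := GG_lip (r := r)
      (bd theta (coef_theta i) mt s hs) (bd bet (coef_bet i) mb s hs) (bd gam (coef_gam i) mg s hs)
      (bd theta (coef_theta i) mt s' hs') (bd bet (coef_bet i) mb s' hs')
      (bd gam (coef_gam i) mg s' hs')
      (dd theta (coef_theta i) s s') (dd bet (coef_bet i) s s') (dd gam (coef_gam i) s s')
    have := mul_le_mul_of_nonneg_left this (Real.exp_pos (-c * r ^ 2)).le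
    linarith
  · exact hg.const_mul _
  · filter_upwards [ae_ne hx] with r hr
    have hr0 : r ≠ 0 := by
      rintro rfl
      simp at hr
    have := ((Lam_deriv r x i hr.1 hr.2).const_mul (Real.exp (-c * r ^ 2))).div_const (r ^ 2)
    refine this.congr_deriv ?_
    field_simp

/-- explicit first partial derivatives of u^T at strictly sorted points. -/
theorem u_first_partial (T t : ℝ) (ht : 0 ≤ t) (htT : t < T) (x : Fin 4 → ℝ)
    (h01 : x 0 < x 1) (h12 : x 1 < x 2) (h23 : x 2 < x 3) (i : Fin 4) :
    HasDerivAt (fun s => u T t (Function.update x i s))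
      ((1 / (16 * Real.sqrt 2)) *
          (∫ r : ℝ, (Real.exp (-(T - t) * r ^ 2) / r) *
            ∑ k, alph k i *
              (psi (r * dot theta x + Real.pi / 2) * Real.sin (r * dot (alph k) x)
                + psi (r * dot theta x) * Real.cos (r * dot (alph k) x)))
        + 1 / 4)
      (x i) := by
  have hth : dot theta x ≠ 0 := by
    have h0 : 0 < Real.sqrt 2 := by positivity
    have : dot theta x = (Real.sqrt 2 / 2) * (x 0 + x 1 - x 2 - x 3) := by
      simp only [dot, Fin.sum_univ_four, theta, inv_sqrt_two]
      simp
      ring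
    rw [this]
    refine mul_ne_zero (by positivity) ?_
    intro h
    linarith
  have hI := int_deriv (T - t) (sub_pos.2 htT) x hth i
  rw [integral_neg] at hI
  have hS : HasDerivAt (fun s => ∑ j, Function.update x i s j) 1 (x i) := by
    have : ∀ s, ∑ j, Function.update x i s j = dot (fun _ => 1) x + 1 * (s - x i) := by
      intro s
      have := dot_update (fun _ => 1) x i s
      rw [← this]
      simp [dot]
    simp only [this]
    simpa using (((hasDerivAt_id (x i)).sub_const (x i)).const_mul 1).const_add
      (dot (fun _ => 1) x)
  have hD := ((hI.const_mul (-(1 / (16 * Real.sqrt 2)))).add (hS.const_mul (1 / 4))).add_const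
    ((1 / 2) * Real.sqrt ((T - t) * Real.pi / 2))
  have hE := hD.congr_of_eventuallyEq (f₁ := fun s => u T t (Function.update x i s)) (by
    filter_upwards [sortv_ev x h01 h12 h23 i] with s hs
    unfold u
    rw [hs]
    rfl)
  refine hE.congr_deriv ?_
  ring

end
end

section
/- For every 0 ≤ t < T and every x ∈ ℝ⁴, the spatial gradient of u^T exists at (t,x) and its components sum to one: Σ_{i=1}^4 ∂_{x_i} u^T(t,x) = 1. In particular the Hessian in x annihilates the vector (1,1,1,1): ∂²_{xx} u^T(t,x)·(1,1,1,1) = 0. -/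
open MeasureTheory Finset

noncomputable section

lemma dot_alph (k : Fin 4) (x : Fin 4 → ℝ) :
    dot (alph k) x = (4 * x k - ∑ i, x i) / Real.sqrt 2 := by
  fin_cases k <;> simp [dot, alph, Fin.sum_univ_four] <;> ring

lemma dot_theta (x : Fin 4 → ℝ) :
    dot theta x = (2 * (x 0 + x 1) - ∑ i, x i) / Real.sqrt 2 := by
  simp [dot, theta, Fin.sum_univ_four]; ring

lemma sum_sortv (x : Fin 4 → ℝ) (f : ℝ → ℝ) : ∑ i, f (sortv x i) = ∑ i, f (x i) :=
  Equiv.sum_comp (Tuple.sort x) (fun i => f (x i))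

/-- the phase -/
def aa (x : Fin 4 → ℝ) : ℝ := dot theta (sortv x)

/-- summand kernel -/
def ker (γ a v r : ℝ) : ℝ :=
  Real.exp (-γ * r ^ 2) * (psi (r * a + Real.pi / 2) * Real.cos (r * v) - 1
    - psi (r * a) * (Real.sin (r * v) - r * v)) / r ^ 2

lemma sum_dot_alph (x : Fin 4 → ℝ) : ∑ k, dot (alph k) x = 0 := by
  simp only [dot_alph, Fin.sum_univ_four]; ring

lemma aa_eq (x : Fin 4 → ℝ) :
    aa x = (2 * (sortv x 0 + sortv x 1) - ∑ i, x i) / Real.sqrt 2 := by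
  rw [aa, dot_theta, sum_sortv x (fun z => z)]

lemma sum_dot_sortv (x : Fin 4 → ℝ) (f : ℝ → ℝ) :
    ∑ k, f (dot (alph k) (sortv x)) = ∑ k, f (dot (alph k) x) := by
  simp only [dot_alph]
  rw [sum_sortv x (fun z => z), sum_sortv x (fun z => f ((4 * z - ∑ i, x i) / Real.sqrt 2))]

lemma integrand_eq (c r : ℝ) (x : Fin 4 → ℝ) :
    Real.exp (-c * r ^ 2) * Lam r (sortv x) / r ^ 2 = ∑ k, ker c (aa x) (dot (alph k) x) r := by
  have h := sum_dot_alph x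
  unfold Lam ker
  rw [sum_dot_sortv x (fun z => Real.cos (r * z)), sum_dot_sortv x (fun z => Real.sin (r * z))]
  change Real.exp (-c * r ^ 2) * (psi (r * aa x + Real.pi / 2) * _ - 4 - psi (r * aa x) * _) / _ = _
  simp only [Fin.sum_univ_four] at h ⊢
  generalize psi (r * aa x + Real.pi / 2) = P
  generalize psi (r * aa x) = Q
  have h3 : dot (alph 3) x = - (dot (alph 0) x + dot (alph 1) x + dot (alph 2) x) := by linarith
  have h4 : r * dot (alph 3) x = - r * (dot (alph 0) x + dot (alph 1) x + dot (alph 2) x) := by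
    rw [h3]; ring
  generalize Real.cos (r * dot (alph 3) x) = C3
  generalize Real.sin (r * dot (alph 3) x) = S3
  rw [h4]
  ring

lemma abs_psi_le (r : ℝ) : |psi r| ≤ 1 := by
  unfold psi
  rcases Real.sign_apply_eq (Real.sin r) with h | h | h <;> rw [h] <;> simp

lemma abs_cos_sub_one_le (z : ℝ) : |Real.cos z - 1| ≤ |z| := by
  have h := Real.cos_sub_cos z 0
  have h1 := Real.abs_sin_le_one ((z + 0) / 2)
  have h2 := Real.abs_sin_le_abs (x := (z - 0) / 2)
  rw [Real.cos_zero] at h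
  rw [h, abs_mul, abs_mul]
  have : |(z - 0) / 2| = |z| / 2 := by simp [abs_div]
  rw [this] at h2
  have : |(-2 : ℝ)| = 2 := by norm_num
  rw [this]
  nlinarith [abs_nonneg (Real.sin ((z - 0) / 2)), abs_nonneg (Real.sin ((z + 0) / 2))]

lemma sinsub_lip (A B : ℝ) :
    |(Real.sin A - A) - (Real.sin B - B)| ≤ (|A| + |B|) * |A - B| := by
  have := Convex.norm_image_sub_le_of_norm_deriv_le (𝕜 := ℝ) (f := fun z => Real.sin z - z)
    (s := Metric.closedBall (0 : ℝ) (|A| + |B|)) (C := |A| + |B|) (x := B) (y := A)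
    (fun x _ => by fun_prop) (fun x hx => by
      have : deriv (fun z => Real.sin z - z) x = Real.cos x - 1 :=
        ((Real.hasDerivAt_sin x).sub (hasDerivAt_id x)).deriv
      rw [this, Real.norm_eq_abs]
      simp at hx
      exact (abs_cos_sub_one_le x).trans hx) (convex_closedBall _ _)
      (by simp) (by simp)
  simpa using this

lemma cos_lip (A B : ℝ) :
    |Real.cos A - Real.cos B| ≤ (|A| + |B|) * |A - B| := by
  have := Convex.norm_image_sub_le_of_norm_deriv_le (𝕜 := ℝ) (f := Real.cos)
    (s := Metric.closedBall (0 : ℝ) (|A| + |B|)) (C := |A| + |B|) (x := B) (y := A)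
    (fun x _ => by fun_prop) (fun x hx => by
      rw [Real.deriv_cos, Real.norm_eq_abs, abs_neg]
      simp at hx
      exact (Real.abs_sin_le_abs).trans hx) (convex_closedBall _ _)
      (by simp) (by simp)
  simpa using this

lemma psi_cos (z : ℝ) : psi (z + Real.pi / 2) = Real.sign (Real.cos z) := by
  unfold psi; rw [Real.sin_add_pi_div_two]

lemma bracket_bound (a v r : ℝ) :
    |psi (r * a + Real.pi / 2) * Real.cos (r * v) - 1
    - psi (r * a) * (Real.sin (r * v) - r * v)| ≤ (a ^ 2 + 2 * v ^ 2) * r ^ 2 := by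
  have h1 : |psi (r * a + Real.pi / 2) - 1| ≤ (r * a) ^ 2 := by
    rcases le_or_gt (Real.cos (r * a)) 0 with h | h
    · have h2 := Real.one_sub_sq_div_two_le_cos (x := r * a)
      have h3 := abs_le.1 (abs_psi_le (r * a + Real.pi / 2))
      rw [abs_le]; constructor <;> nlinarith
    · rw [psi_cos, Real.sign_of_pos h]; simp; positivity
  have h2 := cos_lip (r * v) 0
  have h3 := sinsub_lip (r * v) 0
  simp only [Real.cos_zero, Real.sin_zero, abs_zero, add_zero, sub_zero, abs_mul_abs_self] at h2 h3
  have e : psi (r * a + Real.pi / 2) * Real.cos (r * v) - 1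
      - psi (r * a) * (Real.sin (r * v) - r * v)
      = (psi (r * a + Real.pi / 2) - 1) * Real.cos (r * v) + (Real.cos (r * v) - 1)
      - psi (r * a) * (Real.sin (r * v) - r * v) := by ring
  rw [e]
  refine (abs_sub _ _).trans ?_
  refine (add_le_add (abs_add_le _ _) le_rfl).trans ?_
  rw [abs_mul, abs_mul]
  have h4 := mul_le_mul h1 (Real.abs_cos_le_one (r * v)) (abs_nonneg _) (by positivity)
  have h5 := mul_le_mul (abs_psi_le (r * a)) h3 (abs_nonneg _) (by positivity)
  nlinarith

lemma ker_bound (γ a v r : ℝ) :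
    |ker γ a v r| ≤ (a ^ 2 + 2 * v ^ 2) * Real.exp (-γ * r ^ 2) := by
  unfold ker
  rw [abs_div, abs_mul, Real.abs_exp, abs_of_nonneg (sq_nonneg r)]
  apply div_le_of_le_mul₀ (by positivity) (by positivity)
  nlinarith [bracket_bound a v r, Real.exp_pos (-γ * r ^ 2)]

lemma measurable_ker (γ a v : ℝ) : Measurable (ker γ a v) := by
  unfold ker
  have h1 : Measurable fun r => psi (r * a + Real.pi / 2) := measurable_psi.comp (by fun_prop)
  have h2 : Measurable fun r => psi (r * a) := measurable_psi.comp (by fun_prop)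
  fun_prop

lemma integrable_ker {γ : ℝ} (hγ : 0 < γ) (a v : ℝ) : Integrable (ker γ a v) := by
  refine ((integrable_exp_neg_mul_sq hγ).const_mul (a ^ 2 + 2 * v ^ 2)).mono'
    (measurable_ker γ a v).aestronglyMeasurable (Filter.Eventually.of_forall fun r => ?_)
  exact ker_bound γ a v r

lemma ker_scale (c a v r l : ℝ) (hl : 0 < l) :
    ker c (l * a) v r = l ^ 2 * ker (c / l ^ 2) a (v / l) (l * r) := by
  unfold ker
  have h1 : -(c / l ^ 2) * (l * r) ^ 2 = -c * r ^ 2 := by field_simp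
  have h2 : l * r * a = r * (l * a) := by ring
  have h3 : l * r * (v / l) = r * v := by field_simp
  rw [h1, h2, h3, mul_pow]
  by_cases hr : r = 0
  · simp [hr]
  · field_simp

lemma integral_ker_scale (c a v l : ℝ) (hl : 0 < l) :
    ∫ r, ker c (l * a) v r = l * ∫ r, ker (c / l ^ 2) a (v / l) r := by
  simp_rw [ker_scale c a v _ l hl]
  rw [integral_const_mul, Measure.integral_comp_mul_left (ker (c / l ^ 2) a (v / l)) l,
    abs_of_pos (inv_pos.2 hl), smul_eq_mul]
  field_simp

lemma ker_diff (a γ v : ℝ) (hγ : 0 < γ) :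
    DifferentiableAt ℝ (fun p : ℝ × ℝ => ∫ r, ker p.1 a p.2 r) (γ, v) := by
  have hm1 : Measurable fun r => psi (r * a + Real.pi / 2) := measurable_psi.comp (by fun_prop)
  have hm2 : Measurable fun r => psi (r * a) := measurable_psi.comp (by fun_prop)
  let A : ℝ × ℝ → ℝ → ℝ := fun p r => -(r ^ 2 * ker p.1 a p.2 r)
  let B : ℝ × ℝ → ℝ → ℝ := fun p r =>
    Real.exp (-p.1 * r ^ 2) * (-(psi (r * a + Real.pi / 2) * (r * Real.sin (r * p.2)))
    - psi (r * a) * (r * (Real.cos (r * p.2) - 1))) / r ^ 2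
  let F' : ℝ × ℝ → ℝ → (ℝ × ℝ →L[ℝ] ℝ) := fun p r =>
    A p r • ContinuousLinearMap.fst ℝ ℝ ℝ + B p r • ContinuousLinearMap.snd ℝ ℝ ℝ
  let s : Set (ℝ × ℝ) := Metric.ball (γ, v) (min (γ / 2) 1)
  have hs : s ∈ nhds (γ, v) := Metric.ball_mem_nhds _ (by positivity)
  have hsm : ∀ p ∈ s, γ / 2 ≤ p.1 ∧ |p.2| ≤ |v| + 1 := by
    intro p hp
    have h := Metric.mem_ball.1 hp
    rw [Prod.dist_eq, max_lt_iff, Real.dist_eq, Real.dist_eq] at h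
    have h1 := abs_lt.1 (h.1.trans_le (min_le_left _ _))
    have h2 := h.2.trans_le (min_le_right _ _)
    have h3 := abs_sub_abs_le_abs_sub p.2 v
    simp only at h1 h2 h3
    constructor <;> linarith
  have hq : ∀ p : ℝ × ℝ, ∀ r, |psi (r * a + Real.pi / 2) * (r * Real.sin (r * p.2))| ≤ |p.2| * r ^ 2 := by
    intro p r
    rw [abs_mul, abs_mul]
    have h1 := Real.abs_sin_le_abs (x := r * p.2)
    have h2 := mul_le_mul (abs_psi_le (r * a + Real.pi / 2))
      (mul_le_mul_of_nonneg_left h1 (abs_nonneg r)) (by positivity) (by positivity)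
    rw [abs_mul] at h2
    rw [← sq_abs r]; linarith
  have hq' : ∀ p : ℝ × ℝ, ∀ r, |psi (r * a) * (r * (Real.cos (r * p.2) - 1))| ≤ |p.2| * r ^ 2 := by
    intro p r
    rw [abs_mul, abs_mul]
    have h1 := abs_cos_sub_one_le (r * p.2)
    have h2 := mul_le_mul (abs_psi_le (r * a))
      (mul_le_mul_of_nonneg_left h1 (abs_nonneg r)) (by positivity) (by positivity)
    rw [abs_mul r p.2] at h2
    rw [← sq_abs r]; linarith
  have hB : ∀ p r, |B p r| ≤ 2 * |p.2| * Real.exp (-p.1 * r ^ 2) := by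
    intro p r
    simp only [B]
    rw [abs_div, abs_mul, Real.abs_exp, abs_of_nonneg (sq_nonneg r)]
    apply div_le_of_le_mul₀ (by positivity) (by positivity)
    have : |-(psi (r * a + Real.pi / 2) * (r * Real.sin (r * p.2)))
      - psi (r * a) * (r * (Real.cos (r * p.2) - 1))| ≤ 2 * |p.2| * r ^ 2 := by
      refine (abs_sub _ _).trans ?_
      rw [abs_neg]
      linarith [hq p r, hq' p r]
    nlinarith [Real.exp_pos (-p.1 * r ^ 2)]
  have hexp : ∀ p ∈ s, ∀ r : ℝ, Real.exp (-p.1 * r ^ 2) ≤ Real.exp (-(γ / 2) * r ^ 2) := by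
    intro p hp r
    apply Real.exp_le_exp.2
    nlinarith [(hsm p hp).1, sq_nonneg r]
  let bound : ℝ → ℝ := fun r => (a ^ 2 + 2 * (|v| + 1) ^ 2) * (r ^ 2 * Real.exp (-(γ / 2) * r ^ 2))
    + 2 * (|v| + 1) * Real.exp (-(γ / 2) * r ^ 2)
  have hint : Integrable bound := by
    refine Integrable.add (Integrable.const_mul ?_ _) (Integrable.const_mul ?_ _)
    · have := integrable_rpow_mul_exp_neg_mul_sq (half_pos hγ) (s := 2) (by norm_num)
      simpa using this
    · exact integrable_exp_neg_mul_sq (half_pos hγ)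
  have := hasFDerivAt_integral_of_dominated_of_fderiv_le (𝕜 := ℝ) (μ := volume)
    (F := fun (p : ℝ × ℝ) r => ker p.1 a p.2 r) (F' := F') (x₀ := (γ, v)) (s := s) (bound := bound) hs
    (Filter.Eventually.of_forall fun p => (measurable_ker _ _ _).aestronglyMeasurable)
    (integrable_ker hγ _ _) ?_ ?_ hint ?_
  · exact this.differentiableAt
  · have hA : Measurable (A (γ, v)) := by
      have := measurable_ker γ a v
      simp only [A]; fun_prop
    have hBm : Measurable (B (γ, v)) := by
      simp only [B]; fun_prop
    exact ((hA.aestronglyMeasurable.smul_const _).add (hBm.aestronglyMeasurable.smul_const _))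
  · refine Filter.Eventually.of_forall fun r p hp => ?_
    simp only [F']
    refine (norm_add_le _ _).trans ?_
    rw [norm_smul, norm_smul]
    have h1 := mul_le_mul_of_nonneg_left (ContinuousLinearMap.norm_fst_le ℝ ℝ ℝ) (norm_nonneg (A p r))
    have h2 := mul_le_mul_of_nonneg_left (ContinuousLinearMap.norm_snd_le ℝ ℝ ℝ) (norm_nonneg (B p r))
    have h3 : ‖A p r‖ ≤ (a ^ 2 + 2 * (|v| + 1) ^ 2) * (r ^ 2 * Real.exp (-(γ / 2) * r ^ 2)) := by
      simp only [A, Real.norm_eq_abs]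
      rw [abs_neg, abs_mul, abs_of_nonneg (sq_nonneg r)]
      have h4 : |ker p.1 a p.2 r| ≤ (a ^ 2 + 2 * (|v| + 1) ^ 2) * Real.exp (-(γ / 2) * r ^ 2) := by
        refine (ker_bound _ _ _ _).trans ?_
        have : p.2 ^ 2 ≤ (|v| + 1) ^ 2 := by
          rw [← sq_abs p.2]; exact pow_le_pow_left₀ (abs_nonneg _) (hsm p hp).2 2
        exact mul_le_mul (by linarith) (hexp p hp r) (by positivity) (by positivity)
      nlinarith [sq_nonneg r]
    have h5 : ‖B p r‖ ≤ 2 * (|v| + 1) * Real.exp (-(γ / 2) * r ^ 2) := by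
      refine (hB p r).trans ?_
      exact mul_le_mul (by linarith [(hsm p hp).2]) (hexp p hp r) (by positivity) (by positivity)
    simp only [bound]
    linarith
  · refine Filter.Eventually.of_forall fun r p hp => ?_
    have e1 : HasFDerivAt (fun p : ℝ × ℝ => p.1) (ContinuousLinearMap.fst ℝ ℝ ℝ) p := hasFDerivAt_fst
    have e2 : HasFDerivAt (fun p : ℝ × ℝ => p.2) (ContinuousLinearMap.snd ℝ ℝ ℝ) p := hasFDerivAt_snd
    have g1 := (e1.neg.mul_const (r ^ 2)).exp
    have g2 := (e2.const_mul r)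
    have g3 := ((g2.cos.const_mul (psi (r * a + Real.pi / 2))).sub_const 1).sub
      ((g2.sin.sub g2).const_mul (psi (r * a)))
    have g4 := (g1.mul g3).mul_const ((r ^ 2)⁻¹)
    refine (g4.congr_fderiv ?_).congr_of_eventuallyEq (Filter.Eventually.of_forall fun p => ?_)
    · ext <;> simp [F', A, B, ker] <;> ring
    · simp [ker, div_eq_mul_inv]

lemma sortv_mono (x : Fin 4 → ℝ) : Monotone (sortv x) := Tuple.monotone_sort x

lemma pair_le (x : Fin 4 → ℝ) (i j : Fin 4) (hij : i ≠ j) :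
    sortv x 0 + sortv x 1 ≤ x i + x j := by
  have hi : x i = sortv x ((Tuple.sort x).symm i) := by simp [sortv]
  have hj : x j = sortv x ((Tuple.sort x).symm j) := by simp [sortv]
  have hne : (Tuple.sort x).symm i ≠ (Tuple.sort x).symm j := by simpa using hij
  rw [hi, hj]
  generalize (Tuple.sort x).symm i = a at *
  generalize (Tuple.sort x).symm j = b at *
  have h01 := sortv_mono x (show (0 : Fin 4) ≤ 1 by decide)
  have h12 := sortv_mono x (show (1 : Fin 4) ≤ 2 by decide)
  have h23 := sortv_mono x (show (2 : Fin 4) ≤ 3 by decide)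
  fin_cases a <;> fin_cases b <;> first | (exact absurd rfl hne) | (simp <;> linarith)

lemma sortv_pair_le (x y : Fin 4 → ℝ) :
    sortv x 0 + sortv x 1 ≤ x (Tuple.sort y 0) + x (Tuple.sort y 1) :=
  pair_le x _ _ (by simp)

lemma coord_le (x y : Fin 4 → ℝ) (i : Fin 4) : |x i - y i| ≤ ‖x - y‖ :=
  norm_le_pi_norm (x - y) i

lemma div_sqrt_two_le (z b : ℝ) (h : |z| ≤ b) : |z / Real.sqrt 2| ≤ b := by
  rw [abs_div, abs_of_pos (by positivity : 0 < Real.sqrt 2)]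
  have : 1 ≤ Real.sqrt 2 := Real.one_le_sqrt.2 (by norm_num)
  exact (div_le_self (abs_nonneg _) this).trans h

lemma aa_lip (x y : Fin 4 → ℝ) : |aa x - aa y| ≤ 12 * ‖x - y‖ := by
  rw [aa_eq, aa_eq, ← sub_div]
  apply div_sqrt_two_le
  have h1 := sortv_pair_le x y
  have h2 := sortv_pair_le y x
  have e : ∀ i, sortv x i = x (Tuple.sort x i) := fun _ => rfl
  have e' : ∀ i, sortv y i = y (Tuple.sort y i) := fun _ => rfl
  have c := fun i => abs_le.1 (coord_le x y i)
  have c0 := c 0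
  have c1 := c 1
  have c2 := c 2
  have c3 := c 3
  have d0 := c (Tuple.sort x 0)
  have d1 := c (Tuple.sort x 1)
  have d2 := c (Tuple.sort y 0)
  have d3 := c (Tuple.sort y 1)
  simp only [e, e', Fin.sum_univ_four] at *
  rw [abs_le]; constructor <;> linarith

lemma vv_lip (x y : Fin 4 → ℝ) (k : Fin 4) :
    |dot (alph k) x - dot (alph k) y| ≤ 12 * ‖x - y‖ := by
  rw [dot_alph, dot_alph, ← sub_div]
  apply div_sqrt_two_le
  have c := fun i => abs_le.1 (coord_le x y i)
  have c0 := c 0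
  have c1 := c 1
  have c2 := c 2
  have c3 := c 3
  have ck := c k
  simp only [Fin.sum_univ_four] at *
  rw [abs_le]; constructor <;> linarith

lemma continuous_aa : Continuous aa :=
  (LipschitzWith.of_dist_le_mul (K := 12) (fun x y => by
    rw [Real.dist_eq, dist_eq_norm]; exact aa_lip x y)).continuous

lemma diff_vv (k : Fin 4) : Differentiable ℝ (dot (alph k)) := by
  unfold dot; fun_prop

lemma sortv_add (x : Fin 4 → ℝ) (s : ℝ) : sortv (fun j => x j + s) = fun j => sortv x j + s := by
  have h := (Tuple.comp_sort_eq_comp_iff_monotone (f := fun j => x j + s) (σ := Tuple.sort x)).2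
    (fun i j hij => by
      have := sortv_mono x hij
      simpa [sortv] using this)
  exact h.symm

lemma u_add (T t : ℝ) (x : Fin 4 → ℝ) (s : ℝ) : u T t (fun j => x j + s) = u T t x + s := by
  have h : ∀ r, Lam r (sortv (fun j => x j + s)) = Lam r (sortv x) := by
    intro r
    have h1 : dot theta (sortv (fun j => x j + s)) = dot theta (sortv x) := by
      rw [sortv_add, dot_theta, dot_theta]; simp [Fin.sum_univ_four]; ring
    have h2 : ∀ k, dot (alph k) (sortv (fun j => x j + s)) = dot (alph k) (sortv x) := by
      intro k
      rw [sortv_add, dot_alph, dot_alph]; simp [Fin.sum_univ_four]; ring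
    unfold Lam
    simp only [h1, h2]
  unfold u
  simp only [h, Fin.sum_univ_four]
  ring

lemma u_eq (T t : ℝ) (h : t < T) (x : Fin 4 → ℝ) :
    u T t x = -(1 / (16 * Real.sqrt 2)) * (∑ k, ∫ r, ker (T - t) (aa x) (dot (alph k) x) r)
    + (1 / 4) * ∑ i, x i + (1 / 2) * Real.sqrt ((T - t) * Real.pi / 2) := by
  unfold u
  simp_rw [integrand_eq]
  rw [integral_finsetSum _ (fun k _ => integrable_ker (sub_pos.2 h) _ _)]

/-- sum of integrals -/
def FF (c : ℝ) (x : Fin 4 → ℝ) : ℝ := ∑ k, ∫ r, ker c (aa x) (dot (alph k) x) r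

lemma caseA (c : ℝ) (hc : 0 < c) (x : Fin 4 → ℝ) (hx : sortv x 1 < sortv x 2) :
    DifferentiableAt ℝ (FF c) x := by
  have h01 := sortv_mono x (show (0 : Fin 4) ≤ 1 by decide)
  have h23 := sortv_mono x (show (2 : Fin 4) ≤ 3 by decide)
  have ha0 : aa x < 0 := by
    rw [aa_eq, ← sum_sortv x (fun z => z)]
    apply div_neg_of_neg_of_pos _ (by positivity)
    simp only [Fin.sum_univ_four]
    linarith
  have hev : ∀ᶠ y in nhds x, ∀ i j, i ≠ j →
      y (Tuple.sort x 0) + y (Tuple.sort x 1) ≤ y (Tuple.sort x i) + y (Tuple.sort x j) := by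
    rw [Filter.eventually_all]; intro i
    rw [Filter.eventually_all]; intro j
    by_cases hij : i = j
    · simp [hij]
    by_cases hlt : sortv x 0 + sortv x 1 < sortv x i + sortv x j
    · have : ∀ᶠ y : Fin 4 → ℝ in nhds x, y (Tuple.sort x 0) + y (Tuple.sort x 1)
          < y (Tuple.sort x i) + y (Tuple.sort x j) :=
        ContinuousAt.eventually_lt (by fun_prop) (by fun_prop) hlt
      filter_upwards [this] with y hy _ using hy.le
    · have : (i = 0 ∧ j = 1) ∨ (i = 1 ∧ j = 0) := by
        revert hlt hij
        fin_cases i <;> fin_cases j <;> simp <;> linarith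
      rcases this with ⟨rfl, rfl⟩ | ⟨rfl, rfl⟩
      · simp
      · exact Filter.Eventually.of_forall fun y _ => by linarith
  have haa : ∀ᶠ y in nhds x,
      aa y = (2 * (y (Tuple.sort x 0) + y (Tuple.sort x 1)) - ∑ i, y i) / Real.sqrt 2 := by
    filter_upwards [hev] with y hy
    rw [aa_eq]
    have h1 := sortv_pair_le y x
    have h2 := hy ((Tuple.sort x).symm (Tuple.sort y 0)) ((Tuple.sort x).symm (Tuple.sort y 1))
      (by simp)
    simp only [Equiv.apply_symm_apply] at h2
    have h3 : sortv y 0 + sortv y 1 = y (Tuple.sort x 0) + y (Tuple.sort x 1) :=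
      le_antisymm h1 h2
    rw [h3]
  have hdaa : DifferentiableAt ℝ aa x := by
    refine DifferentiableAt.congr_of_eventuallyEq ?_ haa
    fun_prop
  have hneg : ∀ᶠ y in nhds x, aa y < 0 := continuous_aa.continuousAt.eventually_lt
    continuousAt_const ha0
  have hF : FF c =ᶠ[nhds x] fun y => ∑ k, (aa y / aa x) *
      (fun p : ℝ × ℝ => ∫ r, ker p.1 (aa x) p.2 r)
        (c / (aa y / aa x) ^ 2, dot (alph k) y / (aa y / aa x)) := by
    filter_upwards [hneg] with y hy
    unfold FF
    refine Finset.sum_congr rfl fun k _ => ?_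
    rw [← integral_ker_scale _ _ _ _ (div_pos_of_neg_of_neg hy ha0), div_mul_cancel₀ _ ha0.ne]
  refine DifferentiableAt.congr_of_eventuallyEq ?_ hF
  have hl : aa x / aa x = 1 := div_self ha0.ne
  have hdl : DifferentiableAt ℝ (fun y => aa y / aa x) x := by
    simp only [div_eq_mul_inv]; exact hdaa.mul_const _
  refine DifferentiableAt.fun_sum fun k _ => ?_
  refine hdl.mul ?_
  refine DifferentiableAt.comp x (g := fun p : ℝ × ℝ => ∫ r, ker p.1 (aa x) p.2 r) 
    (f := fun y => (c / (aa y / aa x) ^ 2, dot (alph k) y / (aa y / aa x))) ?_ ?_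
  · rw [hl]
    exact ker_diff _ _ _ (by simpa using hc)
  · refine DifferentiableAt.prodMk ?_ ?_
    · simp only [div_eq_mul_inv c]
      exact ((hdl.fun_pow 2).fun_inv (by simp [hl])).const_mul c
    · simp only [div_eq_mul_inv (dot _ _)]
      exact (diff_vv k x).fun_mul (hdl.fun_inv (by simp [hl]))

lemma sign_diff (A B : ℝ) : |Real.sign A - Real.sign B| * B ^ 2 ≤ 2 * (A - B) ^ 2 := by
  rcases lt_trichotomy A 0 with hA | hA | hA <;> rcases lt_trichotomy B 0 with hB | hB | hB <;>
    simp only [hA, hB, Real.sign_of_neg, Real.sign_of_pos, Real.sign_zero] <;> norm_num <;> nlinarith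

lemma psi_cos_diff (r a b : ℝ) :
    |psi (r * a + Real.pi / 2) - psi (r * b + Real.pi / 2)| * Real.cos (r * b) ^ 2
      ≤ 2 * (r ^ 2 * (a - b) ^ 2) := by
  rw [psi_cos, psi_cos]
  refine (sign_diff _ _).trans ?_
  have h : |Real.cos (r * a) - Real.cos (r * b)| ≤ |r * a - r * b| := by
    have := Real.lipschitzWith_cos.dist_le_mul (r * a) (r * b)
    simpa [Real.dist_eq] using this
  have := sq_le_sq.2 h
  nlinarith

lemma psi_sin_diff (r a b : ℝ) :
    |psi (r * a) - psi (r * b)| * Real.sin (r * b) ^ 2 ≤ 2 * (r ^ 2 * (a - b) ^ 2) := by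
  unfold psi
  refine (sign_diff _ _).trans ?_
  have h : |Real.sin (r * a) - Real.sin (r * b)| ≤ |r * a - r * b| := by
    have := Real.lipschitzWith_sin.dist_le_mul (r * a) (r * b)
    simpa [Real.dist_eq] using this
  have := sq_le_sq.2 h
  nlinarith

lemma tie_vals (x : Fin 4 → ℝ) (hx : sortv x 1 = sortv x 2) :
    ∃ M, dot (alph 0) (sortv x) = M + 2 * aa x ∧ dot (alph 1) (sortv x) = -M ∧
      dot (alph 2) (sortv x) = -M ∧ dot (alph 3) (sortv x) = M - 2 * aa x := by
  refine ⟨(sortv x 0 + sortv x 3 - 2 * sortv x 1) / Real.sqrt 2, ?_⟩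
  rw [aa_eq, ← sum_sortv x (fun z => z)]
  simp only [dot_alph, Fin.sum_univ_four, ← hx]
  refine ⟨?_, ?_, ?_, ?_⟩ <;> ring

lemma tie_cos (x : Fin 4 → ℝ) (hx : sortv x 1 = sortv x 2) (r : ℝ) :
    |∑ k, Real.cos (r * dot (alph k) x)| ≤ 4 * Real.cos (r * aa x) ^ 2 := by
  obtain ⟨M, h0, h1, h2, h3⟩ := tie_vals x hx
  rw [← sum_dot_sortv x (fun z => Real.cos (r * z))]
  simp only [Fin.sum_univ_four, h0, h1, h2, h3]
  have e : Real.cos (r * (M + 2 * aa x)) + Real.cos (r * -M) + Real.cos (r * -M)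
      + Real.cos (r * (M - 2 * aa x)) = Real.cos (r * M) * (4 * Real.cos (r * aa x) ^ 2) := by
    rw [show r * (M + 2 * aa x) = r * M + 2 * (r * aa x) by ring,
      show r * (M - 2 * aa x) = r * M - 2 * (r * aa x) by ring,
      show r * -M = -(r * M) by ring, Real.cos_neg, Real.cos_add, Real.cos_sub, Real.cos_two_mul]
    ring
  rw [e, abs_mul, abs_of_nonneg (by positivity : 0 ≤ 4 * Real.cos (r * aa x) ^ 2)]
  exact mul_le_of_le_one_left (by positivity) (Real.abs_cos_le_one _)

lemma tie_sin (x : Fin 4 → ℝ) (hx : sortv x 1 = sortv x 2) (r : ℝ) :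
    |∑ k, (Real.sin (r * dot (alph k) x) - r * dot (alph k) x)| ≤ 4 * Real.sin (r * aa x) ^ 2 := by
  obtain ⟨M, h0, h1, h2, h3⟩ := tie_vals x hx
  rw [← sum_dot_sortv x (fun z => Real.sin (r * z) - r * z)]
  simp only [Fin.sum_univ_four, h0, h1, h2, h3]
  have e : (Real.sin (r * (M + 2 * aa x)) - r * (M + 2 * aa x)) + (Real.sin (r * -M) - r * -M)
      + (Real.sin (r * -M) - r * -M) + (Real.sin (r * (M - 2 * aa x)) - r * (M - 2 * aa x))
      = -Real.sin (r * M) * (4 * Real.sin (r * aa x) ^ 2) := by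
    rw [show r * (M + 2 * aa x) = r * M + 2 * (r * aa x) by ring,
      show r * (M - 2 * aa x) = r * M - 2 * (r * aa x) by ring,
      show r * -M = -(r * M) by ring, Real.sin_neg, Real.sin_add, Real.sin_sub, Real.cos_two_mul]
    rw [Real.cos_sq']
    ring
  rw [e, abs_mul, abs_of_nonneg (by positivity : 0 ≤ 4 * Real.sin (r * aa x) ^ 2), abs_neg]
  exact mul_le_of_le_one_left (by positivity) (Real.abs_sin_le_one _)

/-- error integrand -/
def EE (c : ℝ) (x₀ x : Fin 4 → ℝ) (r : ℝ) : ℝ :=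
  ∑ k, (ker c (aa x) (dot (alph k) x) r - ker c (aa x₀) (dot (alph k) x) r)

/-- weight -/
def WW (x₀ x : Fin 4 → ℝ) : ℝ := ∑ k, (|dot (alph k) x| + |dot (alph k) x₀|)

lemma WW_nonneg (x₀ x : Fin 4 → ℝ) : 0 ≤ WW x₀ x := Finset.sum_nonneg fun k _ => by positivity

lemma sum_lip (f : ℝ → ℝ) (hf : ∀ A B, |f A - f B| ≤ (|A| + |B|) * |A - B|) (x₀ x : Fin 4 → ℝ)
    (r : ℝ) : |∑ k, f (r * dot (alph k) x)| ≤ |∑ k, f (r * dot (alph k) x₀)|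
      + r ^ 2 * (12 * ‖x - x₀‖ * WW x₀ x) := by
  have h : |∑ k, f (r * dot (alph k) x) - ∑ k, f (r * dot (alph k) x₀)|
      ≤ r ^ 2 * (12 * ‖x - x₀‖ * WW x₀ x) := by
    rw [← Finset.sum_sub_distrib]
    refine (Finset.abs_sum_le_sum_abs _ _).trans ?_
    rw [WW, Finset.mul_sum, Finset.mul_sum]
    refine Finset.sum_le_sum fun k _ => (hf _ _).trans ?_
    rw [← mul_sub, abs_mul, abs_mul, abs_mul, ← sq_abs r]
    have := mul_le_mul_of_nonneg_left (vv_lip x x₀ k)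
      (by positivity : 0 ≤ |r| ^ 2 * (|dot (alph k) x| + |dot (alph k) x₀|))
    linarith
  have := abs_sub_abs_le_abs_sub (∑ k, f (r * dot (alph k) x)) (∑ k, f (r * dot (alph k) x₀))
  linarith

lemma EE_eq (c : ℝ) (x₀ x : Fin 4 → ℝ) (r : ℝ) : EE c x₀ x r = Real.exp (-c * r ^ 2) *
    ((psi (r * aa x + Real.pi / 2) - psi (r * aa x₀ + Real.pi / 2))
      * (∑ k, Real.cos (r * dot (alph k) x))
    - (psi (r * aa x) - psi (r * aa x₀))
      * (∑ k, (Real.sin (r * dot (alph k) x) - r * dot (alph k) x))) / r ^ 2 := by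
  unfold EE ker
  simp only [Fin.sum_univ_four]
  ring

lemma EE_bound (c : ℝ) (x₀ x : Fin 4 → ℝ) (hx : sortv x₀ 1 = sortv x₀ 2) (r : ℝ) :
    |EE c x₀ x r| ≤ Real.exp (-c * r ^ 2) * (2304 * ‖x - x₀‖ ^ 2 + 48 * ‖x - x₀‖ * WW x₀ x) := by
  rw [EE_eq, abs_div, abs_mul, Real.abs_exp, abs_of_nonneg (sq_nonneg r)]
  have hW := WW_nonneg x₀ x
  apply div_le_of_le_mul₀ (by positivity) (by positivity)
  rw [mul_assoc]
  refine mul_le_mul_of_nonneg_left ?_ (Real.exp_pos _).le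
  have hsq : (aa x - aa x₀) ^ 2 ≤ 144 * ‖x - x₀‖ ^ 2 := by
    have := pow_le_pow_left₀ (abs_nonneg _) (aa_lip x x₀) 2
    rw [sq_abs] at this
    linarith
  have hP : |psi (r * aa x + Real.pi / 2) - psi (r * aa x₀ + Real.pi / 2)| ≤ 2 := by
    have := abs_sub (psi (r * aa x + Real.pi / 2)) (psi (r * aa x₀ + Real.pi / 2))
    linarith [abs_psi_le (r * aa x + Real.pi / 2), abs_psi_le (r * aa x₀ + Real.pi / 2)]
  have hQ : |psi (r * aa x) - psi (r * aa x₀)| ≤ 2 := by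
    have := abs_sub (psi (r * aa x)) (psi (r * aa x₀))
    linarith [abs_psi_le (r * aa x), abs_psi_le (r * aa x₀)]
  have hC := sum_lip Real.cos cos_lip x₀ x r
  have hS := sum_lip (fun z => Real.sin z - z) sinsub_lip x₀ x r
  have tC := tie_cos x₀ hx r
  have tS := tie_sin x₀ hx r
  have pC := psi_cos_diff r (aa x) (aa x₀)
  have pS := psi_sin_diff r (aa x) (aa x₀)
  refine (abs_sub _ _).trans ?_
  rw [abs_mul, abs_mul]
  have hP0 := abs_nonneg (psi (r * aa x + Real.pi / 2) - psi (r * aa x₀ + Real.pi / 2))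
  have hQ0 := abs_nonneg (psi (r * aa x) - psi (r * aa x₀))
  generalize |psi (r * aa x + Real.pi / 2) - psi (r * aa x₀ + Real.pi / 2)| = P at *
  generalize |psi (r * aa x) - psi (r * aa x₀)| = Q at *
  have hr := sq_nonneg r
  have hX : 0 ≤ r ^ 2 * (12 * ‖x - x₀‖ * WW x₀ x) := by positivity
  have k1 := mul_le_mul_of_nonneg_left hC hP0
  have k2 := mul_le_mul_of_nonneg_left hS hQ0
  have k3 := mul_le_mul_of_nonneg_left tC hP0
  have k4 := mul_le_mul_of_nonneg_left tS hQ0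
  have k5 := mul_le_mul_of_nonneg_right hP hX
  have k6 := mul_le_mul_of_nonneg_right hQ hX
  have k7 := mul_le_mul_of_nonneg_left hsq hr
  rw [mul_add] at k1 k2
  linarith

lemma WW_bound (x₀ x : Fin 4 → ℝ) : WW x₀ x ≤ 48 * ‖x - x₀‖ + 2 * ∑ k, |dot (alph k) x₀| := by
  unfold WW
  have h : ∀ k, |dot (alph k) x| ≤ |dot (alph k) x₀| + 12 * ‖x - x₀‖ := fun k => by
    have := abs_sub_abs_le_abs_sub (dot (alph k) x) (dot (alph k) x₀)
    linarith [vv_lip x x₀ k]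
  have h0 := h 0
  have h1 := h 1
  have h2 := h 2
  have h3 := h 3
  simp only [Fin.sum_univ_four]
  linarith

lemma tie_zero (x : Fin 4 → ℝ) (hx : sortv x 1 = sortv x 2) (h : aa x = 0) :
    ∑ k, |dot (alph k) x| = 0 := by
  rw [← sum_dot_sortv x (fun z => |z|)]
  have h01 := sortv_mono x (show (0 : Fin 4) ≤ 1 by decide)
  have h23 := sortv_mono x (show (2 : Fin 4) ≤ 3 by decide)
  rw [aa_eq, ← sum_sortv x (fun z => z), div_eq_zero_iff] at h
  have h' := h.resolve_right (by positivity)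
  simp only [Fin.sum_univ_four] at h'
  have e1 : sortv x 1 = sortv x 0 := by linarith
  have e2 : sortv x 2 = sortv x 0 := by linarith
  have e3 : sortv x 3 = sortv x 0 := by linarith
  simp only [dot_alph, Fin.sum_univ_four, e1, e2, e3]
  ring_nf; simp

lemma sign_locconst (f : (Fin 4 → ℝ) → ℝ) (hf : Continuous f) (x : Fin 4 → ℝ) (h : f x ≠ 0) :
    ∀ᶠ y in nhds x, Real.sign (f y) = Real.sign (f x) := by
  rcases lt_or_gt_of_ne h with h | h
  · filter_upwards [hf.continuousAt.eventually_lt continuousAt_const h] with y hy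
    rw [Real.sign_of_neg hy, Real.sign_of_neg h]
  · filter_upwards [continuousAt_const.eventually_lt hf.continuousAt h] with y hy
    rw [Real.sign_of_pos hy, Real.sign_of_pos h]

lemma null_cos (a : ℝ) (ha : a ≠ 0) : ∀ᵐ r : ℝ, Real.cos (r * a) ≠ 0 ∧ Real.sin (r * a) ≠ 0 := by
  have h : (Set.range (fun n : ℤ => (2 * n + 1) * Real.pi / 2 / a) ∪
    Set.range (fun n : ℤ => n * Real.pi / a)).Countable :=
    (Set.countable_range _).union (Set.countable_range _)
  filter_upwards [h.ae_notMem volume] with r hr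
  constructor
  · intro hc
    obtain ⟨n, hn⟩ := Real.cos_eq_zero_iff.1 hc
    exact hr (Or.inl ⟨n, by simp only; rw [← hn]; field_simp⟩)
  · intro hc
    obtain ⟨n, hn⟩ := Real.sin_eq_zero_iff.1 hc
    exact hr (Or.inr ⟨n, by simp only; rw [hn]; field_simp⟩)

lemma caseB (c : ℝ) (hc : 0 < c) (x : Fin 4 → ℝ) (hx : sortv x 1 = sortv x 2) :
    DifferentiableAt ℝ (FF c) x := by
  have hI : ∀ y, Integrable (EE c x y) := fun y => by
    unfold EE
    exact integrable_finsetSum _ fun k _ => (integrable_ker hc _ _).sub (integrable_ker hc _ _)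
  have hF : FF c = fun y => (∑ k, (fun p : ℝ × ℝ => ∫ r, ker p.1 (aa x) p.2 r) (c, dot (alph k) y))
      + ∫ r, EE c x y r := by
    funext y
    unfold EE FF
    have hk : ∀ k ∈ (Finset.univ : Finset (Fin 4)), Integrable (fun r =>
        ker c (aa y) (dot (alph k) y) r - ker c (aa x) (dot (alph k) y) r) :=
      fun k _ => (integrable_ker hc _ _).sub (integrable_ker hc _ _)
    rw [integral_finsetSum _ hk,
      ← Finset.sum_add_distrib]
    refine Finset.sum_congr rfl fun k _ => ?_
    rw [integral_sub (integrable_ker hc _ _) (integrable_ker hc _ _)]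
    ring
  rw [hF]
  have hE0 : ∀ r, EE c x x r = 0 := fun r => by simp [EE]
  refine DifferentiableAt.fun_add (DifferentiableAt.fun_sum fun k _ => ?_) ?_
  · refine DifferentiableAt.comp x (g := fun p : ℝ × ℝ => ∫ r, ker p.1 (aa x) p.2 r) 
      (f := fun y => (c, dot (alph k) y)) (ker_diff _ _ _ hc) ?_
    exact (differentiableAt_const c).prodMk (diff_vv k x)
  · set K := 2304 + 48 * (48 + 2 * ∑ k, |dot (alph k) x|) with hK
    have := hasFDerivAt_integral_of_dominated_loc_of_lip' (𝕜 := ℝ) (μ := volume)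
      (F := EE c x) (F' := fun _ => 0) (x₀ := x) (s := Metric.ball x 1)
      (bound := fun r => K * Real.exp (-c * r ^ 2)) (Metric.ball_mem_nhds _ one_pos)
      (fun y _ => (hI y).aestronglyMeasurable) (hI x) aestronglyMeasurable_const ?_
      ((integrable_exp_neg_mul_sq hc).const_mul K) ?_
    · exact this.2.differentiableAt
    · refine Filter.Eventually.of_forall fun r y hy => ?_
      rw [hE0, sub_zero, Real.norm_eq_abs]
      refine (EE_bound c x y hx r).trans ?_
      rw [Metric.mem_ball, dist_eq_norm] at hy
      have hd := norm_nonneg (y - x)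
      have hW := WW_bound x y
      generalize ‖y - x‖ = d at *
      have : 2304 * d ^ 2 + 48 * d * WW x y ≤ K * d := by
        have : WW x y ≤ 48 + 2 * ∑ k, |dot (alph k) x| := by linarith
        nlinarith [mul_le_mul_of_nonneg_left this hd]
      nlinarith [Real.exp_pos (-c * r ^ 2)]
    · by_cases ha : aa x = 0
      · refine Filter.Eventually.of_forall fun r => ?_
        refine Asymptotics.IsBigO.hasFDerivAt (n := 2) ?_ (by norm_num)
        refine Asymptotics.IsBigO.of_bound (Real.exp (-c * r ^ 2) * (2304 + 48 * 48))
          (Filter.Eventually.of_forall fun y => ?_)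
        rw [Real.norm_eq_abs, Real.norm_of_nonneg (by positivity)]
        refine (EE_bound c x y hx r).trans ?_
        have hW := WW_bound x y
        rw [tie_zero x hx ha] at hW
        rw [mul_assoc (Real.exp _)]
        refine mul_le_mul_of_nonneg_left ?_ (Real.exp_pos _).le
        nlinarith [norm_nonneg (y - x)]
      · filter_upwards [null_cos (aa x) ha] with r hr
        have h1 := sign_locconst (fun y => Real.cos (r * aa y))
          (Real.continuous_cos.comp (continuous_const.mul continuous_aa)) x hr.1
        have h2 := sign_locconst (fun y => Real.sin (r * aa y))
          (Real.continuous_sin.comp (continuous_const.mul continuous_aa)) x hr.2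
        refine (hasFDerivAt_const (0 : ℝ) x).congr_of_eventuallyEq ?_
        filter_upwards [h1, h2] with y h1 h2
        rw [EE_eq, psi_cos, psi_cos, psi, psi, h1, h2]
        simp

lemma u_diff (T t : ℝ) (h : t < T) (x : Fin 4 → ℝ) : DifferentiableAt ℝ (u T t) x := by
  have hF : DifferentiableAt ℝ (FF (T - t)) x := by
    rcases (sortv_mono x (show (1 : Fin 4) ≤ 2 by decide)).lt_or_eq with h1 | h1
    · exact caseA _ (sub_pos.2 h) x h1
    · exact caseB _ (sub_pos.2 h) x h1
  have : u T t = fun x => -(1 / (16 * Real.sqrt 2)) * FF (T - t) x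
    + (1 / 4) * ∑ i, x i + (1 / 2) * Real.sqrt ((T - t) * Real.pi / 2) := funext (u_eq T t h)
  rw [this]
  fun_prop

/-- the spatial gradient of u^T exists, its components sum to one,
and the spatial Hessian annihilates the vector (1,1,1,1). -/
theorem u_gradient_sum_one (T t : ℝ) (ht : 0 ≤ t) (htT : t < T) (x : Fin 4 → ℝ) :
    (∀ i, DifferentiableAt ℝ (fun s => u T t (Function.update x i s)) (x i)) ∧
    (∑ i, pd i (u T t) x) = 1 ∧
    (∀ i, HasDerivAt (fun s : ℝ => pd i (u T t) (fun j => x j + s)) 0 0) := by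
  have hup : ∀ (y : Fin 4 → ℝ) (i : Fin 4), HasDerivAt (fun s => u T t (Function.update y i s))
      (fderiv ℝ (u T t) y (Pi.single i 1)) (y i) := by
    intro y i
    have h1 : HasFDerivAt (u T t) (fderiv ℝ (u T t) y) (Function.update y i (y i)) := by
      rw [Function.update_eq_self]; exact (u_diff T t htT y).hasFDerivAt
    exact h1.comp_hasDerivAt (y i) (hasDerivAt_update y i (y i))
  refine ⟨fun i => (hup x i).differentiableAt, ?_, ?_⟩
  · have h1 : ∀ i, pd i (u T t) x = fderiv ℝ (u T t) x (Pi.single i 1) := fun i => (hup x i).deriv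
    simp only [h1]
    rw [← map_sum]
    have h2 : HasDerivAt (fun s : ℝ => (fun j => x j + s)) (∑ i : Fin 4, Pi.single i (1 : ℝ)) 0 := by
      rw [hasDerivAt_pi]
      intro j
      have : (∑ i : Fin 4, (Pi.single i (1 : ℝ) : Fin 4 → ℝ)) j = 1 := by
        simp [Finset.sum_apply, Pi.single_apply]
      rw [this]
      exact (hasDerivAt_id (0 : ℝ)).const_add (x j)
    have h3 : HasFDerivAt (u T t) (fderiv ℝ (u T t) x) (fun j => x j + (0 : ℝ)) := by
      simp only [add_zero]; exact (u_diff T t htT x).hasFDerivAt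
    have h4 := h3.comp_hasDerivAt (0 : ℝ) h2
    have h5 : HasDerivAt (fun s : ℝ => u T t x + s) 1 0 :=
      (hasDerivAt_id (0 : ℝ)).const_add (u T t x)
    have h6 : (u T t ∘ fun (s : ℝ) j => x j + s) = fun s : ℝ => u T t x + s :=
      funext fun s => u_add T t x s
    rw [h6] at h4
    exact h4.unique h5
  · intro i
    have h : ∀ s : ℝ, pd i (u T t) (fun j => x j + s) = pd i (u T t) x := by
      intro s
      have e : (fun z => u T t (Function.update (fun j => x j + s) i z))
          = fun z => u T t (Function.update x i (z - s)) + s := by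
        funext z
        rw [← u_add]
        congr 1
        funext j
        by_cases hj : j = i
        · subst hj; simp
        · simp [hj]
      unfold pd
      simp only [e]
      rw [deriv_add_const, deriv_comp_sub_const (f := fun z => u T t (Function.update x i z))]
      simp
    simp only [h]
    exact hasDerivAt_const _ _

end
end
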